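/- Let V be a finite set, G a directed acyclic graph on V, and (X_v)_{v∈V} a family of random variables on a probability space (Ω, 𝓕, P), each valued in a nonempty finite type, satisfying the Markov condition with respect to G. Then for every X ∈ V, the set mb(X) = Pa(X) ∪ Ch(X) ∪ Sp(X) is a Markov blanket of X: the variable X_X is conditionally independent of the family (X_w)_{w ∈ V \ (mb(X) ∪ {X})} given the family (X_m)_{m ∈ mb(X)}; in particular, for every individual Y ∈ V \ (mb(X) ∪ {X}), X_X and X_Y are conditionally independent given (X_m)_{m ∈ mb(X)}. -/

import Mathlib

open MeasureTheory ProbabilityTheory Set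

namespace CFS

variable {V : Type*}

/-- Parents of `v`: vertices with an edge into `v`. -/
def Pa (E : V → V → Prop) (v : V) : Set V := {u | E u v}

/-- Children of `v`: vertices with an edge from `v`. -/
def Ch (E : V → V → Prop) (v : V) : Set V := {u | E v u}

/-- Descendants of `v`: vertices reachable from `v` by a nonempty directed path. -/
def Desc (E : V → V → Prop) (v : V) : Set V := {u | Relation.TransGen E v u}

/-- Spouses of `v`: the other parents of the children of `v`. -/
def Sp (E : V → V → Prop) (v : V) : Set V := {u | u ≠ v ∧ ∃ w, E u w ∧ E v w}

/-- The Markov blanket set `mb(v)` in the graph: parents, children and spouses. -/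
def mb (E : V → V → Prop) (v : V) : Set V := Pa E v ∪ Ch E v ∪ Sp E v

/-- The edge relation is acyclic (defines a DAG). -/
def Acyclic (E : V → V → Prop) : Prop := ∀ v, ¬ Relation.TransGen E v v

/-- Adjacency: an edge in either direction. -/
def Adj (E : V → V → Prop) (u v : V) : Prop := E u v ∨ E v u

/-- `f 0, f 1, …, f n` is an undirected path between `i` and `j`:
distinct vertices, consecutive ones adjacent. -/
structure IsUPath (E : V → V → Prop) (i j : V) (n : ℕ) (f : ℕ → V) : Prop where
  pos : 0 < n
  start : f 0 = i
  finish : f n = j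
  inj : ∀ s ≤ n, ∀ t ≤ n, f s = f t → s = t
  adj : ∀ t < n, Adj E (f t) (f (t + 1))

/-- The interior vertex at position `t` of the path `f` is a collider:
both incident edges of the path point into it. -/
def ColliderAt (E : V → V → Prop) (f : ℕ → V) (t : ℕ) : Prop :=
  E (f (t - 1)) (f t) ∧ E (f (t + 1)) (f t)

/-- The path `f 0, …, f n` is blocked by `S`: some interior non-collider lies in `S`,
or some interior collider is such that neither it nor any of its descendants lies in `S`. -/
def Blocked (E : V → V → Prop) (S : Set V) (n : ℕ) (f : ℕ → V) : Prop :=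
  ∃ t, 0 < t ∧ t < n ∧
    ((¬ ColliderAt E f t ∧ f t ∈ S) ∨
      (ColliderAt E f t ∧ f t ∉ S ∧ ∀ d ∈ Desc E (f t), d ∉ S))

/-- `i` and `j` are d-separated by `S`: every undirected path between them is blocked by `S`. -/
def DSep (E : V → V → Prop) (i j : V) (S : Set V) : Prop :=
  ∀ n f, IsUPath E i j n f → Blocked E S n f

/-- The sets `A` and `B` are d-separated by `S`. -/
def DSepSet (E : V → V → Prop) (A B S : Set V) : Prop :=
  ∀ i ∈ A, ∀ j ∈ B, DSep E i j S

variable {Ω Val : Type*} [mΩ : MeasurableSpace Ω] [MeasurableSpace Val]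

/-- The σ-algebra generated by the family of random variables `(X v)_{v ∈ A}`. -/
def famSigma (X : V → Ω → Val) (A : Set V) : MeasurableSpace Ω :=
  ⨆ v ∈ A, MeasurableSpace.comap (X v) inferInstance

theorem famSigma_le {X : V → Ω → Val} (hX : ∀ v, Measurable (X v)) (A : Set V) :
    famSigma X A ≤ mΩ :=
  iSup₂_le fun v _ => (hX v).comap_le

/-- The families `(X a)_{a ∈ A}` and `(X b)_{b ∈ B}` are conditionally independent
given the family `(X s)_{s ∈ S}`. -/
def CondIndepFam [StandardBorelSpace Ω] (X : V → Ω → Val) (hX : ∀ v, Measurable (X v))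
    (P : Measure Ω) [IsFiniteMeasure P] (S A B : Set V) : Prop :=
  CondIndep (famSigma X S) (famSigma X A) (famSigma X B) (famSigma_le hX S) P

/-- The Markov condition: every variable is conditionally independent of its
non-descendants (other than itself and its parents) given its parents. -/
def MarkovCondition [StandardBorelSpace Ω] (E : V → V → Prop) (X : V → Ω → Val)
    (hX : ∀ v, Measurable (X v)) (P : Measure Ω) [IsFiniteMeasure P] : Prop :=
  ∀ v, CondIndepFam X hX P (Pa E v) {v} (univ \ ({v} ∪ Desc E v ∪ Pa E v))

/-- `M ⊆ V \ {C}` is a Markov blanket of `C`: conditioned on `(X m)_{m ∈ M}`,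
all other variables are independent of `X C`. -/
def IsMarkovBlanket [StandardBorelSpace Ω] (X : V → Ω → Val) (hX : ∀ v, Measurable (X v))
    (P : Measure Ω) [IsFiniteMeasure P] (C : V) (M : Set V) : Prop :=
  C ∉ M ∧ CondIndepFam X hX P M {C} (univ \ (M ∪ {C}))

/-- A Markov boundary of `C` is a Markov blanket of `C` no proper subset of which
is a Markov blanket of `C`. -/
def IsMarkovBoundary [StandardBorelSpace Ω] (X : V → Ω → Val) (hX : ∀ v, Measurable (X v))
    (P : Measure Ω) [IsFiniteMeasure P] (C : V) (M : Set V) : Prop :=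
  IsMarkovBlanket X hX P C M ∧ ∀ M' ⊂ M, ¬ IsMarkovBlanket X hX P C M'

/-- Faithfulness: conditional independence holds exactly when d-separation holds. -/
def Faithful [StandardBorelSpace Ω] (E : V → V → Prop) (X : V → Ω → Val)
    (hX : ∀ v, Measurable (X v)) (P : Measure Ω) [IsFiniteMeasure P] : Prop :=
  ∀ A B S : Set V, A.Nonempty → B.Nonempty →
    Disjoint A B → Disjoint A S → Disjoint B S →
    (CondIndepFam X hX P S A B ↔ DSepSet E A B S)

/-- `v` is strongly relevant to `C`: `X C` and `X v` are not conditionally independent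
given all the remaining variables. -/
def StronglyRelevant [StandardBorelSpace Ω] (X : V → Ω → Val) (hX : ∀ v, Measurable (X v))
    (P : Measure Ω) [IsFiniteMeasure P] (C v : V) : Prop :=
  ¬ CondIndepFam X hX P (univ \ {C, v}) {C} {v}

end CFS

open CFS

theorem aux_pull {Ω : Type*} {m' mΩ : MeasurableSpace Ω} (hm' : m' ≤ mΩ)
    (μ : Measure Ω) [IsProbabilityMeasure μ] (a b : Set Ω) (hb : MeasurableSet b) :
    μ[b.indicator (μ⟦a | m'⟧) | m'] =ᵐ[μ] (μ⟦a | m'⟧) * (μ⟦b | m'⟧) := by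
  have hI : Integrable (b.indicator (fun _ => (1 : ℝ))) μ :=
    (integrable_const 1).indicator hb
  have e : b.indicator (μ⟦a | m'⟧) = (μ⟦a | m'⟧) * b.indicator (fun _ => (1 : ℝ)) := by
    ext x
    by_cases hx : x ∈ b <;> simp [hx]
  have := condExp_mul_of_stronglyMeasurable_left (μ := μ) (m := m')
    (f := μ⟦a | m'⟧) (g := b.indicator (fun _ => (1 : ℝ))) stronglyMeasurable_condExp
    (by rw [← e]; exact integrable_condExp.indicator hb) hI
  rw [e]; exact this

theorem aux_gen {Ω : Type*} (m m' : MeasurableSpace Ω) :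
    m ⊔ m' = MeasurableSpace.generateFrom
      {t | ∃ b s, MeasurableSet[m] b ∧ MeasurableSet[m'] s ∧ t = s ∩ b} := by
  apply le_antisymm
  · refine sup_le (fun t ht => ?_) (fun t ht => ?_)
    · exact MeasurableSpace.measurableSet_generateFrom ⟨t, univ, ht, MeasurableSet.univ, by simp⟩
    · exact MeasurableSpace.measurableSet_generateFrom ⟨univ, t, MeasurableSet.univ, ht, by simp⟩
  · refine MeasurableSpace.generateFrom_le ?_
    rintro t ⟨b, s, hb, hs, rfl⟩
    exact MeasurableSet.inter ((le_sup_right : m' ≤ m ⊔ m') _ hs)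
      ((le_sup_left : m ≤ m ⊔ m') _ hb)

theorem aux_indep_iff {Ω : Type*} {m' m₁ m₂ mΩ : MeasurableSpace Ω} [StandardBorelSpace Ω]
    (hm' : m' ≤ mΩ) (hm₁ : m₁ ≤ mΩ) (hm₂ : m₂ ≤ mΩ) (μ : Measure Ω) [IsProbabilityMeasure μ] :
    CondIndep m' m₁ m₂ hm' μ ↔
      ∀ a, MeasurableSet[m₁] a → (μ⟦a | m₂ ⊔ m'⟧) =ᵐ[μ] (μ⟦a | m'⟧) := by
  have hle : m₂ ⊔ m' ≤ mΩ := sup_le hm₂ hm'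
  have hint : ∀ a : Set Ω, MeasurableSet a → Integrable (a.indicator (fun _ => (1 : ℝ))) μ :=
    fun a ha => (integrable_const 1).indicator ha
  have hab : ∀ a b : Set Ω, (a ∩ b).indicator (fun _ => (1 : ℝ))
      = b.indicator (a.indicator (fun _ => (1 : ℝ))) := by
    intro a b; rw [Set.indicator_indicator, Set.inter_comm]
  rw [condIndep_iff _ _ _ hm' hm₁ hm₂]
  constructor
  · intro h a ha
    have hIa := hint a (hm₁ _ ha)
    have hsm : StronglyMeasurable[m₂ ⊔ m'] (μ⟦a | m'⟧) :=
      (stronglyMeasurable_condExp (m := m')).mono (le_sup_right : m' ≤ m₂ ⊔ m')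
    symm
    refine ae_eq_condExp_of_forall_setIntegral_eq hle hIa
      (fun _ _ _ => integrable_condExp.integrableOn) ?_
      hsm.aestronglyMeasurable
    intro t ht _
    refine MeasurableSpace.induction_on_inter (m := m₂ ⊔ m')
      (C := fun t _ => ∫ x in t, (μ⟦a | m'⟧) x ∂μ
        = ∫ x in t, a.indicator (fun _ => (1 : ℝ)) x ∂μ)
      (aux_gen m₂ m') ?_ (by simp) ?_ ?_ ?_ t ht
    · rintro _ ⟨b, s, hb, hs, rfl⟩ _ ⟨b', s', hb', hs', rfl⟩ _
      exact ⟨b ∩ b', s ∩ s', MeasurableSet.inter hb hb', MeasurableSet.inter hs hs',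
        Set.inter_inter_inter_comm _ _ _ _⟩
    · rintro _ ⟨b, s, hb, hs, rfl⟩
      have hb0 := hm₂ _ hb
      rw [← setIntegral_indicator hb0, ← setIntegral_indicator hb0,
        ← setIntegral_condExp hm' (integrable_condExp.indicator hb0) hs,
        ← setIntegral_condExp hm' (hIa.indicator hb0) hs, ← hab]
      refine setIntegral_congr_ae (hm' _ hs) ?_
      filter_upwards [aux_pull hm' μ a b hb0, h a b ha hb] with x h1 h2 _
      rw [h1, h2]
    · intro t ht h
      have h1 := integral_add_compl (μ := μ) (hle _ ht) (integrable_condExp (m := m')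
        (f := a.indicator (fun _ => (1 : ℝ))))
      have h2 := integral_add_compl (μ := μ) (hle _ ht) hIa
      rw [integral_condExp hm'] at h1
      linarith
    · intro f hd hf h
      rw [integral_iUnion (fun i => hle _ (hf i)) hd integrable_condExp.integrableOn,
        integral_iUnion (fun i => hle _ (hf i)) hd hIa.integrableOn]
      simp only [h]
  · intro h a b ha hb
    have hb0 := hm₂ _ hb
    have hIa := hint a (hm₁ _ ha)
    have h1 : (μ⟦a ∩ b | m₂ ⊔ m'⟧) =ᵐ[μ] b.indicator (μ⟦a | m'⟧) := by
      rw [hab]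
      refine (condExp_indicator hIa ((le_sup_left : m₂ ≤ m₂ ⊔ m') _ hb)).trans ?_
      filter_upwards [h a ha] with x hx
      by_cases hxb : x ∈ b <;> simp [hxb, hx]
    refine (condExp_condExp_of_le (le_sup_right : m' ≤ m₂ ⊔ m') hle).symm.trans ?_
    exact (condExp_congr_ae h1).trans (aux_pull hm' μ a b hb0)

section Fam
variable {V Ω Val : Type*} [mΩ : MeasurableSpace Ω] [StandardBorelSpace Ω]
    [MeasurableSpace Val] {X : V → Ω → Val} {hX : ∀ v, Measurable (X v)}
    {P : Measure Ω} [IsProbabilityMeasure P]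

theorem aux_fam_mono {A B : Set V} (h : A ⊆ B) : famSigma X A ≤ famSigma X B :=
  biSup_mono fun _ hv => h hv

theorem aux_fam_union (A B : Set V) : famSigma X (A ∪ B) = famSigma X A ⊔ famSigma X B :=
  iSup_union

theorem aux_fam_iff (S A B : Set V) : CondIndepFam X hX P S A B ↔
    ∀ a, MeasurableSet[famSigma X A] a →
      (P⟦a | famSigma X (B ∪ S)⟧) =ᵐ[P] (P⟦a | famSigma X S⟧) := by
  unfold CondIndepFam
  rw [aux_indep_iff _ (famSigma_le hX A) (famSigma_le hX B), aux_fam_union]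

theorem aux_wu {S A B S' B' : Set V} (h : CondIndepFam X hX P S A B)
    (h1 : S ⊆ S') (h2 : S' ⊆ S ∪ B) (h3 : B' ⊆ S ∪ B) : CondIndepFam X hX P S' A B' := by
  rw [aux_fam_iff] at h ⊢
  have key : ∀ T : Set V, S ⊆ T → T ⊆ B ∪ S → ∀ a, MeasurableSet[famSigma X A] a →
      (P⟦a | famSigma X T⟧) =ᵐ[P] (P⟦a | famSigma X S⟧) := by
    intro T hT1 hT2 a ha
    refine (condExp_condExp_of_le (aux_fam_mono (X := X) hT2) (famSigma_le hX _)).symm.trans ?_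
    refine (condExp_congr_ae (h a ha)).trans ?_
    rw [condExp_of_stronglyMeasurable (famSigma_le hX _)
      (stronglyMeasurable_condExp.mono (aux_fam_mono (X := X) hT1)) integrable_condExp]
  intro a ha
  have c : S ∪ B = B ∪ S := Set.union_comm _ _
  exact (key _ (h1.trans Set.subset_union_right) (c ▸ Set.union_subset h3 h2) a ha).trans
    (key _ h1 (c ▸ h2) a ha).symm

theorem aux_contr {S A B B' : Set V} (h : CondIndepFam X hX P S A B)
    (h' : CondIndepFam X hX P (S ∪ B) A B') : CondIndepFam X hX P S A (B ∪ B') := by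
  rw [aux_fam_iff] at h h' ⊢
  intro a ha
  have e : B ∪ B' ∪ S = B' ∪ (S ∪ B) := by ext; simp; tauto
  have := h' a ha
  rw [e]
  rw [Set.union_comm S B] at this ⊢
  exact this.trans (h a ha)

theorem aux_symm {S A B : Set V} (h : CondIndepFam X hX P S A B) :
    CondIndepFam X hX P S B A := CondIndep.symm h

/-- Blanket relative to a vertex set. -/
def mbIn (E : V → V → Prop) (C : V) (A : Set V) : Set V :=
  {u | u ≠ C ∧ (E u C ∨ (E C u ∧ u ∈ A) ∨ ∃ w ∈ A, E u w ∧ E C w)}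

theorem aux_main [Finite V] (E : V → V → Prop) (hE : Acyclic E)
    (hM : MarkovCondition E X hX P) (C : V) (n : ℕ) :
    ∀ A : Set V, A.ncard = n → C ∈ A → (∀ u w, E u w → w ∈ A → u ∈ A) →
      CondIndepFam X hX P (mbIn E C A) {C} (A \ {C}) := by
  have hirr : ∀ v, ¬ E v v := fun v h => hE v (.single h)
  induction n with
  | zero =>
    intro A hA hC
    rw [Set.ncard_eq_zero] at hA
    simp [hA] at hC
  | succ n ih =>
    intro A hA hC hcl
    by_cases hD : (A ∩ Desc E C).Nonempty
    · -- a last descendant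
      obtain ⟨v, ⟨hvA, hvC⟩, hmax⟩ : ∃ v ∈ A ∩ Desc E C,
          ∀ w ∈ A ∩ Desc E C, ¬ Relation.TransGen E v w := by
        let r : V → V → Prop := fun x y => Relation.TransGen E y x
        haveI : IsTrans V r := ⟨fun _ _ _ h1 h2 => Relation.TransGen.trans h2 h1⟩
        haveI : Std.Irrefl r := ⟨hE⟩
        obtain ⟨v, hv, h⟩ := (Finite.wellFounded_of_trans_of_irrefl r).has_min _ hD
        exact ⟨v, hv, fun w hw => h w hw⟩
      have hvne : v ≠ C := by rintro rfl; exact hE _ hvC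
      have hnd : ∀ w ∈ A, ¬ Relation.TransGen E v w := fun w hw hvw =>
        hmax w ⟨hw, Relation.TransGen.trans hvC hvw⟩ hvw
      have hnE : ∀ w ∈ A, ¬ E v w := fun w hw h => hnd w hw (.single h)
      obtain ⟨A', hA'⟩ : ∃ A' : Set V, A' = A \ {v} := ⟨_, rfl⟩
      have hmem : ∀ x, x ∈ A' ↔ x ∈ A ∧ x ≠ v := by intro x; simp [hA']
      have hI := ih A' (by rw [hA', Set.ncard_diff_singleton_of_mem hvA, hA]; rfl)
        ((hmem _).2 ⟨hC, hvne.symm⟩)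
        (fun u w huw hw => (hmem _).2 ⟨hcl u w huw ((hmem _).1 hw).1, by
          rintro rfl; exact hnE w ((hmem _).1 hw).1 huw⟩)
      have hv : CondIndepFam X hX P (Pa E v) {v} A' := by
        refine aux_wu (hM v) subset_rfl Set.subset_union_left ?_
        intro x hx
        have hx := (hmem _).1 hx
        have := hnd x hx.1
        simp only [Set.mem_union, Set.mem_diff, Set.mem_univ, true_and, Desc, Set.mem_setOf_eq,
          Set.mem_singleton_iff]
        tauto
      have hPaA : ∀ x, E x v → x ∈ A' := fun x hx =>
        (hmem _).2 ⟨hcl _ _ hx hvA, by rintro rfl; exact hirr _ hx⟩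
      have hCA : C ∈ A' := (hmem _).2 ⟨hC, hvne.symm⟩
      have hMA : ∀ x ∈ mbIn E C A', x ∈ A' ∧ x ≠ C := by
        rintro x ⟨hxC, h | h | ⟨w, hw, h1, h2⟩⟩
        · exact ⟨(hmem _).2 ⟨hcl _ _ h hC, by rintro rfl; exact hnE _ hC h⟩, hxC⟩
        · exact ⟨h.2, hxC⟩
        · have hw := (hmem _).1 hw
          exact ⟨(hmem _).2 ⟨hcl _ _ h1 hw.1, by rintro rfl; exact hnE _ hw.1 h1⟩, hxC⟩
      by_cases hCv : E C v
      · obtain ⟨N, hN⟩ : ∃ N : Set V, N = mbIn E C A' ∪ (Pa E v \ {C}) := ⟨_, rfl⟩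
        have hNA : ∀ x ∈ N, x ∈ A' ∧ x ≠ C := by
          intro x hx
          rw [hN] at hx
          rcases hx with hx | hx
          · exact hMA x hx
          · exact ⟨hPaA x hx.1, hx.2⟩
        have h1 : CondIndepFam X hX P N {C} (A' \ {C}) := by
          refine aux_wu hI (hN ▸ Set.subset_union_left) ?_ Set.subset_union_right
          intro x hx; exact Or.inr (hNA x hx)
        have h2 : CondIndepFam X hX P (N ∪ {C}) {v} (A' \ {C}) := by
          refine aux_wu hv ?_ ?_ ?_
          · intro x hx
            by_cases hxC : x = C
            · exact Or.inr hxC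
            · exact Or.inl (hN ▸ Or.inr ⟨hx, hxC⟩)
          · rintro x (hx | hx)
            · exact Or.inr (hNA x hx).1
            · exact Or.inr (hx ▸ hCA)
          · intro x hx; exact Or.inr hx.1
        have h3 := aux_contr (aux_symm h1) (aux_symm h2)
        have h4 : CondIndepFam X hX P (N ∪ {v}) (A' \ {C}) {C} := by
          refine aux_wu h3 Set.subset_union_left ?_ ?_
          · intro x; simp; tauto
          · intro x; simp; tauto
        have e : mbIn E C A = N ∪ {v} := by
          ext x
          rw [hN]
          simp only [mbIn, Set.mem_union, Set.mem_setOf_eq, Set.mem_diff, Set.mem_singleton_iff, Pa]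
          constructor
          · rintro ⟨hxC, h⟩
            by_cases hxv : x = v
            · exact Or.inr hxv
            left
            rcases h with h | h | ⟨w, hw, h1, h2⟩
            · exact Or.inl ⟨hxC, Or.inl h⟩
            · exact Or.inl ⟨hxC, Or.inr (Or.inl ⟨h.1, (hmem _).2 ⟨h.2, hxv⟩⟩)⟩
            · by_cases hwv : w = v
              · exact Or.inr ⟨hwv ▸ h1, hxC⟩
              · exact Or.inl ⟨hxC, Or.inr (Or.inr ⟨w, (hmem _).2 ⟨hw, hwv⟩, h1, h2⟩)⟩
          · rintro ((⟨hxC, h | h | ⟨w, hw, h1, h2⟩⟩ | h) | rfl)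
            · exact ⟨hxC, Or.inl h⟩
            · exact ⟨hxC, Or.inr (Or.inl ⟨h.1, ((hmem _).1 h.2).1⟩)⟩
            · exact ⟨hxC, Or.inr (Or.inr ⟨w, ((hmem _).1 hw).1, h1, h2⟩)⟩
            · exact ⟨h.2, Or.inr (Or.inr ⟨v, hvA, h.1, hCv⟩)⟩
            · exact ⟨hvne, Or.inr (Or.inl ⟨hCv, hvA⟩)⟩
        rw [e]
        refine aux_wu (aux_symm h4) subset_rfl Set.subset_union_left ?_
        intro x hx
        by_cases hxv : x = v
        · exact Or.inl (Or.inr hxv)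
        · exact Or.inr ⟨(hmem _).2 ⟨hx.1, hxv⟩, hx.2⟩
      · have e : mbIn E C A = mbIn E C A' := by
          ext x
          simp only [mbIn, Set.mem_setOf_eq]
          constructor
          · rintro ⟨hxC, h | h | ⟨w, hw, h1, h2⟩⟩
            · exact ⟨hxC, Or.inl h⟩
            · exact ⟨hxC, Or.inr (Or.inl ⟨h.1, (hmem _).2 ⟨h.2, by
                rintro rfl; exact hCv h.1⟩⟩)⟩
            · exact ⟨hxC, Or.inr (Or.inr ⟨w, (hmem _).2 ⟨hw, by
                rintro rfl; exact hCv h2⟩, h1, h2⟩)⟩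
          · rintro ⟨hxC, h | h | ⟨w, hw, h1, h2⟩⟩
            · exact ⟨hxC, Or.inl h⟩
            · exact ⟨hxC, Or.inr (Or.inl ⟨h.1, ((hmem _).1 h.2).1⟩)⟩
            · exact ⟨hxC, Or.inr (Or.inr ⟨w, ((hmem _).1 hw).1, h1, h2⟩)⟩
        rw [e]
        have e2 : mbIn E C A' ∪ A' \ {C} = A' \ {C} := Set.union_eq_right.2 hMA
        have h2 : CondIndepFam X hX P (mbIn E C A' ∪ A' \ {C}) {v} {C} := by
          rw [e2]
          refine aux_wu hv ?_ ?_ ?_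
          · intro x hx
            exact ⟨hPaA x hx, by rintro rfl; exact hCv hx⟩
          · intro x hx; exact Or.inr hx.1
          · intro x hx; exact Or.inr (hx ▸ hCA)
        refine aux_wu (aux_contr hI (aux_symm h2)) subset_rfl Set.subset_union_left ?_
        intro x hx
        by_cases hxv : x = v
        · exact Or.inr (Or.inr hxv)
        · exact Or.inr (Or.inl ⟨(hmem _).2 ⟨hx.1, hxv⟩, hx.2⟩)
    · have hnd : ∀ w ∈ A, ¬ Relation.TransGen E C w := fun w hw h => hD ⟨w, hw, h⟩
      have e : mbIn E C A = Pa E C := by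
        ext x
        simp only [mbIn, Set.mem_setOf_eq, Pa]
        constructor
        · rintro ⟨hxC, h | h | ⟨w, hw, h1, h2⟩⟩
          · exact h
          · exact absurd (.single h.1) (hnd x h.2)
          · exact absurd (.single h2) (hnd w hw)
        · intro h
          exact ⟨by rintro rfl; exact hirr _ h, Or.inl h⟩
      rw [e]
      refine aux_wu (hM C) subset_rfl Set.subset_union_left ?_
      rintro x ⟨hx, hxC⟩
      have := hnd x hx
      simp only [Set.mem_union, Set.mem_diff, Set.mem_univ, true_and, Desc, Set.mem_setOf_eq,
        Set.mem_singleton_iff] at hxC ⊢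
      tauto

end Fam


/-- Under the Markov condition, `mb(C) = Pa(C) ∪ Ch(C) ∪ Sp(C)` is a Markov blanket of `C`;
in particular `X C` is conditionally independent of each individual variable outside
`mb(C) ∪ {C}` given the family over `mb(C)`. -/
theorem stmt_1
    {V Ω Val : Type*} [Fintype V] [MeasurableSpace Ω] [StandardBorelSpace Ω]
    [MeasurableSpace Val] [DiscreteMeasurableSpace Val] [Fintype Val] [Nonempty Val]
    (E : V → V → Prop) (hE : Acyclic E)
    (X : V → Ω → Val) (hX : ∀ v, Measurable (X v))
    (P : MeasureTheory.Measure Ω) [MeasureTheory.IsProbabilityMeasure P]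
    (hMarkov : MarkovCondition E X hX P)
    (C : V) :
    IsMarkovBlanket X hX P C (mb E C) ∧
    ∀ Y, Y ≠ C → Y ∉ mb E C → CondIndepFam X hX P (mb E C) {C} {Y} := by
  have hirr : ∀ v, ¬ E v v := fun v h => hE v (.single h)
  have hCm : C ∉ mb E C := by
    rintro ((h | h) | h)
    · exact hirr _ h
    · exact hirr _ h
    · exact h.1 rfl
  have h := aux_main E hE hMarkov C _ Set.univ rfl (Set.mem_univ _) (fun _ _ _ _ => Set.mem_univ _)
  have e : mbIn E C Set.univ = mb E C := by
    ext x
    by_cases hxC : x = C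
    · subst hxC
      simp [mbIn, hCm]
    · simp [mbIn, mb, Pa, Ch, Sp, hxC, or_assoc]
  rw [e] at h
  refine ⟨⟨hCm, aux_wu h subset_rfl Set.subset_union_left ?_⟩, fun Y hY _ =>
    aux_wu h subset_rfl Set.subset_union_left ?_⟩
  · intro x hx
    exact Or.inr ⟨Set.mem_univ _, fun hxC => hx.2 (Or.inr hxC)⟩
  · rintro x rfl
    exact Or.inr ⟨Set.mem_univ _, hY⟩
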